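/- Fix 0 < ρ < 1, let τ₀, τ* and B(ξ,τ) be defined below, and for ξ > 0, τ₀(ξ) < τ < τ*(ξ) define φ(ξ,τ) = ((1 − B·e^{−ρτ})/ρ)·(1 + e^{ρτ}·(B + ρ − 1)/(1 − B))·log(1 − B·e^{−ρτ}) − log(1 − B) − (B/ρ)(1 − e^{−ρτ}), where B = B(ξ,τ). Then φ(ξ,τ) < 0 for every (ξ,τ) with ξ > 0 and τ₀(ξ) < τ < τ*(ξ). -/

import Mathlib

/-- The curve `τ₀(ξ) = (1/ρ) log(1 + ρξ/(1-ρ))`. -/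
noncomputable def psTau0 (ρ ξ : ℝ) : ℝ := (1 / ρ) * Real.log (1 + ρ * ξ / (1 - ρ))

/-- The curve `τ*(ξ) = (1/ρ) log(1 + (ρξ + √(ρ²ξ² + 4ρξ(1-√ρ)))/(2(1-√ρ)))`. -/
noncomputable def psTauStar (ρ ξ : ℝ) : ℝ :=
  (1 / ρ) * Real.log (1 +
    (ρ * ξ + Real.sqrt (ρ ^ 2 * ξ ^ 2 + 4 * ρ * ξ * (1 - Real.sqrt ρ))) /
      (2 * (1 - Real.sqrt ρ)))

/-- The ray parameter `B(ξ,τ)` in region `R₂`. -/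
noncomputable def psB (ρ ξ τ : ℝ) : ℝ :=
  (Real.exp (2 * ρ * τ) - 1 - ρ * ξ * Real.exp (ρ * τ) -
      Real.sqrt ((ρ * ξ * Real.exp (ρ * τ) + 1 - Real.exp (2 * ρ * τ)) ^ 2 -
        4 * Real.exp (ρ * τ) * (Real.exp (ρ * τ) - 1) *
          ((1 - ρ) * (Real.exp (ρ * τ) - 1) - ρ * ξ))) /
    (2 * (Real.exp (ρ * τ) - 1))

/-- The exponent function `φ(ξ,τ)` in region `R₂`. -/
noncomputable def psPhiR2 (ρ ξ τ : ℝ) : ℝ :=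
  ((1 - psB ρ ξ τ * Real.exp (-(ρ * τ))) / ρ) *
      (1 + Real.exp (ρ * τ) * (psB ρ ξ τ + ρ - 1) / (1 - psB ρ ξ τ)) *
      Real.log (1 - psB ρ ξ τ * Real.exp (-(ρ * τ))) -
    Real.log (1 - psB ρ ξ τ) - (psB ρ ξ τ / ρ) * (1 - Real.exp (-(ρ * τ)))

theorem ps_log_slope (a y : ℝ) (ha : 0 < a) (hay : a < y) (hy : y < 1) :
    y * Real.log y * (1 - a) ≤ a * Real.log a * (1 - y) := by
  have hy0 : 0 < y := ha.trans hay
  have p1 : 0 ≤ (y - a) / (y * (1 - a)) :=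
    div_nonneg (by linarith) (mul_nonneg hy0.le (by linarith))
  have p2 : 0 ≤ a * (1 - y) / (y * (1 - a)) :=
    div_nonneg (mul_nonneg ha.le (by linarith)) (mul_nonneg hy0.le (by linarith))
  have p3 : (y - a) / (y * (1 - a)) + a * (1 - y) / (y * (1 - a)) = 1 := by
    have : 1 - a ≠ 0 := by linarith
    field_simp
    ring
  have h := (strictConcaveOn_log_Ioi.concaveOn).2 (Set.mem_Ioi.2 one_pos)
    (Set.mem_Ioi.2 (inv_pos.2 ha)) p1 p2 p3
  have e : (y - a) / (y * (1 - a)) * 1 + a * (1 - y) / (y * (1 - a)) * a⁻¹ = y⁻¹ := by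
    have : 1 - a ≠ 0 := by linarith
    field_simp
    ring
  simp only [smul_eq_mul] at h
  rw [e, Real.log_one, Real.log_inv, Real.log_inv, mul_zero, zero_add, div_mul_eq_mul_div,
    div_le_iff₀ (by apply mul_pos <;> linarith)] at h
  nlinarith

theorem ps_key (ρ B E : ℝ) (h0 : 0 < ρ) (hB : 0 < B) (hB1 : B < 1) (hE : 1 < E) :
    ((1 - B * E⁻¹) / ρ) * (1 + E * (B + ρ - 1) / (1 - B)) * Real.log (1 - B * E⁻¹) -
      Real.log (1 - B) - (B / ρ) * (1 - E⁻¹) < 0 := by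
  have hE0 : 0 < E := by linarith
  obtain ⟨u, hu⟩ : ∃ u, u = B * E⁻¹ := ⟨_, rfl⟩
  have hBu : B = u * E := by rw [hu]; field_simp
  have hu0 : 0 < u := by rw [hu]; positivity
  have huB : u < B := by nlinarith
  have hs := ps_log_slope (1 - B) (1 - u) (by linarith) (by linarith) (by linarith)
  have hl : -u < (1 - u) * Real.log (1 - u) := by
    have hy : 0 < 1 - u := by linarith
    have := Real.log_lt_sub_one_of_pos (inv_pos.2 hy) (by
      intro h
      have := inv_eq_one.1 h
      linarith)
    rw [Real.log_inv] at this
    have h2 := mul_lt_mul_of_pos_left this hy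
    rw [mul_sub, mul_inv_cancel₀ hy.ne'] at h2
    linarith
  rw [← hu]
  have hEe : E = B / u := by rw [hBu]; field_simp
  generalize Real.log (1 - u) = l at *
  generalize Real.log (1 - B) = m at *
  have key : ((1 - u) / ρ) * (1 + E * (B + ρ - 1) / (1 - B)) * l - m - (B / ρ) * (1 - E⁻¹)
      = (-((B - u) * (u + (1 - u) * l)) * (1 - B)
        + ρ * ((1 - u) * l * (1 - (1 - B)) - (1 - B) * m * (1 - (1 - u)))) / (ρ * u * (1 - B)) := by
    have : 1 - B ≠ 0 := by linarith
    rw [hEe]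
    field_simp
    ring
  rw [key]
  apply div_neg_of_neg_of_pos
  · have a1 : 0 < (B - u) * (u + (1 - u) * l) * (1 - B) := by
      apply mul_pos (mul_pos _ _) <;> linarith
    have a2 := mul_nonneg h0.le (sub_nonneg.2 hs)
    linarith
  · apply mul_pos (mul_pos h0 hu0); linarith

/-- in region `R₂` the exponent `φ(ξ,τ)` is strictly negative,
i.e. the conditional sojourn time density is exponentially small in `N`. -/
theorem psPhiR2_neg (ρ : ℝ) (h0 : 0 < ρ) (h1 : ρ < 1) :
    ∀ ξ : ℝ, 0 < ξ → ∀ τ : ℝ, psTau0 ρ ξ < τ → τ < psTauStar ρ ξ →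
      psPhiR2 ρ ξ τ < 0 := by
  intro ξ hξ τ h2 _
  have hr : 0 < 1 - ρ := by linarith
  have hx : 0 < ρ * ξ := mul_pos h0 hξ
  have hC : 1 + ρ * ξ / (1 - ρ) < Real.exp (ρ * τ) := by
    unfold psTau0 at h2
    have : 0 < 1 + ρ * ξ / (1 - ρ) := by positivity
    rw [← Real.log_lt_iff_lt_exp this]
    rw [one_div, inv_mul_eq_div, div_lt_iff₀ h0] at h2
    linarith
  have e2 : Real.exp (2 * ρ * τ) = Real.exp (ρ * τ) ^ 2 := by
    rw [← Real.exp_nat_mul]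
    congr 1
    push_cast
    ring
  have hE : 1 < Real.exp (ρ * τ) := by
    have : 0 < ρ * ξ / (1 - ρ) := by positivity
    linarith
  have hB : 0 < psB ρ ξ τ ∧ psB ρ ξ τ < 1 := by
    unfold psB
    rw [e2]
    generalize Real.exp (ρ * τ) = E at *
    generalize ρ * ξ = x at *
    have hC' : 0 < (1 - ρ) * (E - 1) - x := by
      have : x / (1 - ρ) < E - 1 := by linarith
      rw [div_lt_iff₀ hr] at this
      linarith
    have hd : 0 < E - 1 := by linarith
    have hf : (E - 1) - (E ^ 2 - 1 - x * E) + E * ((1 - ρ) * (E - 1) - x) < 0 := by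
      have : 0 < ρ * E * (E - 1) := by positivity
      nlinarith
    generalize (1 - ρ) * (E - 1) - x = C at *
    have hEC : 0 < E * C := by positivity
    have hP : 0 < (E - 1) * (E * C) := by positivity
    constructor
    · apply div_pos _ (by linarith)
      rw [sub_pos, Real.sqrt_lt' (by linarith)]
      nlinarith
    · rw [div_lt_one (by linarith), sub_lt_comm]
      apply Real.lt_sqrt_of_sq_lt
      have := mul_neg_of_pos_of_neg hd hf
      nlinarith
  unfold psPhiR2
  rw [Real.exp_neg]
  exact ps_key ρ _ _ h0 hB.1 hB.2 hE
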